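/- Fix m ≥ 1, a, b_1,…,b_m, c_1,…,c_m ∈ ℂ, set β_{0,i} = b_i, β_{1,i} = c_i − 1 − b_i, and let σ_k·v be v with the k-th coordinate flipped. Then for every k ∈ {1,…,m}, every v ∈ {0,1}^m with v_k = 0, and all t, x ∈ ℂ^m with x_k·t_k(t_k − 1)(1 − Σ_i t_i x_i)·∏_{i=1}^m (t_i − v_i) ≠ 0, one has a t_k / ((1 − Σ_i t_i x_i)·∏_{i=1}^m (t_i − v_i)) = (1/x_k)·[ −β_{0,k}/∏_{i=1}^m (t_i − v_i) − β_{1,k}/∏_{i=1}^m (t_i − (σ_k·v)_i) + ω_{T_k}(t,x)/∏_{1≤i≤m, i≠k}(t_i − v_i) ], where ω_{T_k}(t,x) = β_{0,k}/t_k + β_{1,k}/(t_k − 1) + a x_k/(1 − Σ_i t_i x_i). -/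

import Mathlib

open Finset

/-- `v_i ∈ {0,1}` regarded as a complex number. -/
def bval (s : Bool) : ℂ := if s then 1 else 0

/-- The parameters `β_{0,i} = b_i`, `β_{1,i} = c_i − 1 − b_i`. -/
def betaP {m : ℕ} (b c : Fin m → ℂ) (s : Bool) (i : Fin m) : ℂ :=
  if s then c i - 1 - b i else b i

/-- `ω_{T_j}(t,x) = β_{0,j}/t_j + β_{1,j}/(t_j − 1) + a x_j/(1 − Σ t_i x_i)`. -/
noncomputable def omegaT {m : ℕ} (a : ℂ) (b c : Fin m → ℂ) (t x : Fin m → ℂ) (j : Fin m) : ℂ :=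
  betaP b c false j / t j + betaP b c true j / (t j - 1) + a * x j / (1 - ∑ i, t i * x i)

/-- `σ_j·v` : flip the `j`-th coordinate of `v`. -/
def flipv {m : ℕ} (j : Fin m) (v : Fin m → Bool) : Fin m → Bool :=
  Function.update v j (!(v j))

theorem prod_sub_bval_eq_mul_erase {m : ℕ} (t : Fin m → ℂ) (v : Fin m → Bool) (k : Fin m) :
    ∏ i, (t i - bval (v i)) =
      (t k - bval (v k)) * ∏ i ∈ univ.erase k, (t i - bval (v i)) :=
  (mul_prod_erase univ (fun i => t i - bval (v i)) (mem_univ k)).symm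

theorem prod_sub_bval_flipv {m : ℕ} (t : Fin m → ℂ) (v : Fin m → Bool) (k : Fin m) :
    ∏ i, (t i - bval (flipv k v i)) =
      (t k - bval (!(v k))) * ∏ i ∈ univ.erase k, (t i - bval (v i)) := by
  rw [prod_sub_bval_eq_mul_erase t (flipv k v) k]
  congr 1
  · simp [flipv]
  · refine prod_congr rfl fun i hi => ?_
    simp [flipv, Function.update_of_ne (ne_of_mem_erase hi)]

/-- **Proposition 4.2, case `v_k = 0` (scalar form).** For every `k`, every `v ∈ {0,1}^m`
with `v_k = 0`, and all `t, x` with `x_k·t_k(t_k − 1)(1 − Σ t_i x_i)·∏(t_i − v_i) ≠ 0`: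
`a t_k/((1 − Σ t_i x_i)·∏(t_i − v_i))
  = (1/x_k)·[−β_{0,k}/∏(t_i − v_i) − β_{1,k}/∏(t_i − (σ_k·v)_i) + ω_{T_k}/∏_{i≠k}(t_i − v_i)]`. -/
theorem stmt_6 (m : ℕ) (hm : 1 ≤ m) (a : ℂ) (b c : Fin m → ℂ)
    (k : Fin m) (v : Fin m → Bool) (hvk : v k = false) (t x : Fin m → ℂ)
    (h : x k * t k * (t k - 1) * (1 - ∑ i, t i * x i) * ∏ i, (t i - bval (v i)) ≠ 0) :
    a * t k / ((1 - ∑ i, t i * x i) * ∏ i, (t i - bval (v i))) =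
      (1 / x k) *
        (- betaP b c false k / ∏ i, (t i - bval (v i))
          - betaP b c true k / ∏ i, (t i - bval (flipv k v i))
          + omegaT a b c t x k / ∏ i ∈ univ.erase k, (t i - bval (v i))) := by
  rw [prod_sub_bval_flipv]
  rw [prod_sub_bval_eq_mul_erase t v k] at h ⊢
  simp only [hvk, bval, Bool.not_false, Bool.false_eq_true, if_true, if_false, sub_zero,
    mul_ne_zero_iff] at h ⊢
  obtain ⟨⟨⟨⟨hx, ht⟩, ht1⟩, hS⟩, -, hQ⟩ := h
  unfold omegaT
  generalize 1 - ∑ i, t i * x i = S at hS ⊢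
  generalize ∏ i ∈ univ.erase k, (t i - if v i = true then (1 : ℂ) else 0) = Q at hQ ⊢
  field_simp
  ring
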